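/- arXiv:1112.1241 — 3 statements merged into one kernel-verified Lean document; each statement's English description precedes it below -/
import Mathlib

section
/- Let f, h : E → ℝ be bounded measurable functions and u : E → ℝ a measurable function such that the maps (x,y) ↦ |f(x)−f(y)|·|u(x)−u(y)| and (x,y) ↦ |h(x)−h(y)|·|u(x)−u(y)| are J̃-integrable. Then ∫_{E×E} [f(y)·(h(x)−h(y)) + h(y)·(f(x)−f(y))]·(u(x)−u(y)) dJ̃(x,y) = ∫_{E×E} (h(x)·f(x) − h(y)·f(y))·(u(x)−u(y)) dJ(x,y). (All integrands vanish on the diagonal, so no restriction to the off-diagonal set is needed.) -/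
open MeasureTheory

/-- Integration against the symmetrization `(J + Ĵ)/2` averages the integrand over the swap. -/
theorem integral_symmetrization {E : Type*} [MeasurableSpace E] (J : Measure (E × E))
    {A : E × E → ℝ}
    (hA : Integrable A ((2 : ENNReal)⁻¹ • (J + Measure.map Prod.swap J))) :
    ∫ p, A p ∂((2 : ENNReal)⁻¹ • (J + Measure.map Prod.swap J))
      = ∫ p, (A p + A p.swap) / 2 ∂J := by
  rw [integrable_smul_measure (by simp) (by simp), integrable_add_measure] at hA
  obtain ⟨hJ, hmap⟩ := hA
  have hswap : Integrable (fun p : E × E => A p.swap) J := hmap.comp_measurable measurable_swap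
  rw [integral_smul_measure, integral_add_measure hJ hmap,
    integral_map measurable_swap.aemeasurable hmap.aestronglyMeasurable,
    integral_div, integral_add hJ hswap]
  simp only [ENNReal.toReal_inv, ENNReal.toReal_ofNat, smul_eq_mul]
  ring

/-- A bounded measurable function times `(g x - g y) (u x - u y)` is integrable as soon as
`|g x - g y| |u x - u y|` is. -/
theorem integrable_bdd_mul_sub_mul_sub {E : Type*} [MeasurableSpace E] {μ : Measure (E × E)}
    {f g u : E → ℝ} (hf : Measurable f) (hg : Measurable g) (hu : Measurable u)
    {C : ℝ} (hfb : ∀ x, |f x| ≤ C)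
    (hint : Integrable (fun p : E × E => |g p.1 - g p.2| * |u p.1 - u p.2|) μ) :
    Integrable (fun p : E × E => f p.2 * ((g p.1 - g p.2) * (u p.1 - u p.2))) μ := by
  refine Integrable.bdd_mul (c := C) ?_ (hf.comp measurable_snd).aestronglyMeasurable
    (Filter.Eventually.of_forall fun p => hfb p.2)
  refine hint.mono (by fun_prop) (Filter.Eventually.of_forall fun p => ?_)
  simp

/-- The core symmetrization identity for the jumping measure: with
`J̃ = (J + Ĵ)/2` the symmetrization of `J` (where `Ĵ` is the image of `J`
under the swap map), for bounded measurable `f, h` and measurable `u` with the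
stated integrability,
`∫ [f(y)(h(x)−h(y)) + h(y)(f(x)−f(y))](u(x)−u(y)) dJ̃ =
 ∫ (h(x)f(x) − h(y)f(y))(u(x)−u(y)) dJ`. -/
theorem statement3 {E : Type*} [MeasurableSpace E] (J : Measure (E × E))
    (Jtilde : Measure (E × E))
    (hJt : Jtilde = (2 : ENNReal)⁻¹ • (J + Measure.map Prod.swap J))
    (f h u : E → ℝ)
    (hf : Measurable f) (hh : Measurable h) (hu : Measurable u)
    (Cf : ℝ) (hfb : ∀ x, |f x| ≤ Cf)
    (Ch : ℝ) (hhb : ∀ x, |h x| ≤ Ch)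
    (hif : Integrable (fun p : E × E => |f p.1 - f p.2| * |u p.1 - u p.2|) Jtilde)
    (hih : Integrable (fun p : E × E => |h p.1 - h p.2| * |u p.1 - u p.2|) Jtilde) :
    ∫ p : E × E,
        (f p.2 * (h p.1 - h p.2) + h p.2 * (f p.1 - f p.2)) * (u p.1 - u p.2)
        ∂Jtilde
      = ∫ p : E × E, (h p.1 * f p.1 - h p.2 * f p.2) * (u p.1 - u p.2) ∂J := by
  subst hJt
  have hA := (integrable_bdd_mul_sub_mul_sub hf hh hu hfb hih).add
    (integrable_bdd_mul_sub_mul_sub hh hf hu hhb hif)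
  rw [integral_symmetrization J (hA.congr (Filter.Eventually.of_forall fun p => by
    simp only [Pi.add_apply]; ring))]
  refine integral_congr_ae (Filter.Eventually.of_forall fun p => ?_)
  simp only [Prod.fst_swap, Prod.snd_swap]
  ring
end

section
/- Let (Ω, 𝓐, P) be a probability space and let N : Ω × [0,∞) → ℝ be a stochastic process such that ω ↦ N(ω,t) is measurable for each t and t ↦ N(ω,t) is continuous for each ω. Let 0 = t_0 < t_1 < ... < t_p be a partition, K > 0, η > 0, and set a(t) := max{ t_k : 0 ≤ k ≤ p, t_k ≤ t }. Then P( sup_{t ∈ [0,K]} Σ_{k=0}^{p−1} (N(t ∧ t_{k+1}) − N(t ∧ t_k))² > η ) ≤ (2/η)·E[ Σ_{k=0}^{p−1} (N(K ∧ t_{k+1}) − N(K ∧ t_k))² ] + P( sup_{t ∈ [0,K]} (N(t) − N(a(t)))² > η/2 ), where the expectation is allowed to be +∞ (in which case the inequality is trivial). -/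
open MeasureTheory

/-- If `u` is the largest point `≤ s` of a partition, then the discrete quadratic variation at
`s ≤ K` exceeds the one at `K` by at most the square of the straddling increment. -/
theorem sum_sq_increments_min_le (f : ℝ → ℝ) {p : ℕ} {t : ℕ → ℝ}
    (ht : StrictMonoOn t (Set.Iic p)) {s K u : ℝ} (hsK : s ≤ K)
    (hu : IsGreatest {x | ∃ k ≤ p, t k = x ∧ x ≤ s} u) :
    ∑ k ∈ Finset.range p, (f (min s (t (k + 1))) - f (min s (t k))) ^ 2
      ≤ ∑ k ∈ Finset.range p, (f (min K (t (k + 1))) - f (min K (t k))) ^ 2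
        + (f s - f u) ^ 2 := by
  obtain ⟨⟨j, hj, rfl, hjs⟩, hmax⟩ := hu
  have hlt : ∀ k ≤ p, j < k → s < t k := fun k hk hjk =>
    not_le.1 fun h => (ht hj hk hjk).not_ge (hmax ⟨k, hk, rfl, h⟩)
  have hle : ∀ k ≤ j, t k ≤ s := fun k hk =>
    (ht.monotoneOn (Set.mem_Iic.2 (hk.trans hj)) hj hk).trans hjs
  calc
    _ ≤ ∑ k ∈ Finset.range p, ((f (min K (t (k + 1))) - f (min K (t k))) ^ 2
          + if k = j then (f s - f (t j)) ^ 2 else 0) := by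
      refine Finset.sum_le_sum fun k hk => ?_
      have hkp : k + 1 ≤ p := Finset.mem_range.1 hk
      rcases lt_trichotomy k j with h | rfl | h
      · have h₁ := hle k h.le
        have h₂ := hle (k + 1) h
        simp [h.ne, h₁, h₂, h₁.trans hsK, h₂.trans hsK]
      · simp [(hlt (k + 1) hkp k.lt_succ_self).le, hjs, sq_nonneg]
      · have h₁ := (hlt k (by omega) h).le
        have h₂ := (hlt (k + 1) hkp (by omega)).le
        simp [h.ne', h₁, h₂, sq_nonneg]
    _ ≤ _ := by
      rw [Finset.sum_add_distrib, Finset.sum_ite_eq']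
      gcongr
      split_ifs
      exacts [le_rfl, sq_nonneg _]

/-- The squared increments of a continuous function between points `b s ∈ [0, s]` and `s` are
bounded over `s ∈ [0, K]`. -/
theorem bddAbove_range_sq_sub {f : ℝ → ℝ} (hf : Continuous f) {b : ℝ → ℝ} {K : ℝ}
    (hb : ∀ s, 0 ≤ s → b s ∈ Set.Icc 0 s) :
    BddAbove (Set.range fun s : Set.Icc (0 : ℝ) K => (f s - f (b s)) ^ 2) := by
  obtain ⟨C, hC⟩ := isCompact_Icc.exists_bound_of_continuousOn (hf.continuousOn (s := Set.Icc 0 K))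
  refine ⟨(C + C) ^ 2, ?_⟩
  rintro _ ⟨⟨s, hs⟩, rfl⟩
  have hbs := hb s hs.1
  have h := (norm_sub_le (f s) (f (b s))).trans
    (add_le_add (hC s hs) (hC (b s) ⟨hbs.1, hbs.2.trans hs.2⟩))
  exact sq_le_sq' (neg_le_of_abs_le h) (le_of_abs_le h)

/-- The basic Markov/straddling estimate for the running discrete quadratic
variation of a continuous process `N` along a partition
`0 = t 0 < ... < t p`: for `K, η > 0`,
`P(sup_{s ≤ K} Σ (N(s∧t_{k+1})−N(s∧t_k))² > η)
   ≤ (2/η) E[Σ (N(K∧t_{k+1})−N(K∧t_k))²]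
     + P(sup_{s ≤ K} (N(s)−N(a(s)))² > η/2)`,
where `a s` is the largest partition point `≤ s` and the expectation (a lower
integral) may be `+∞`. -/
theorem statement9 {Ω : Type*} [MeasurableSpace Ω] (P : Measure Ω)
    [IsProbabilityMeasure P]
    (N : Ω → ℝ → ℝ)
    (hmeas : ∀ s : ℝ, Measurable fun ω => N ω s)
    (hcont : ∀ ω, Continuous (N ω))
    (p : ℕ) (t : ℕ → ℝ) (ht0 : t 0 = 0)
    (htmono : ∀ k < p, t k < t (k + 1))
    (K η : ℝ) (hK : 0 < K) (hη : 0 < η)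
    (a : ℝ → ℝ)
    (ha : ∀ s : ℝ, 0 ≤ s → IsGreatest {x | ∃ k ≤ p, t k = x ∧ x ≤ s} (a s)) :
    P {ω | η < ⨆ s : Set.Icc (0 : ℝ) K,
          ∑ k ∈ Finset.range p,
            (N ω (min (s : ℝ) (t (k + 1))) - N ω (min (s : ℝ) (t k))) ^ 2}
      ≤ ENNReal.ofReal (2 / η) *
          (∫⁻ ω, ENNReal.ofReal (∑ k ∈ Finset.range p,
            (N ω (min K (t (k + 1))) - N ω (min K (t k))) ^ 2) ∂P)
        + P {ω | η / 2 < ⨆ s : Set.Icc (0 : ℝ) K,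
            (N ω (s : ℝ) - N ω (a (s : ℝ))) ^ 2} := by
  have ht : StrictMonoOn t (Set.Iic p) :=
    strictMonoOn_of_lt_add_one Set.ordConnected_Iic fun k _ _ hk => htmono k hk
  have haIcc : ∀ s, 0 ≤ s → a s ∈ Set.Icc 0 s := fun s hs => by
    obtain ⟨_, _, _, h⟩ := (ha s hs).1
    exact ⟨(ha s hs).2 ⟨0, p.zero_le, ht0, hs⟩, h⟩
  have : Nonempty (Set.Icc (0 : ℝ) K) := ⟨⟨0, le_rfl, hK.le⟩⟩
  set S : Ω → ℝ := fun ω => ∑ k ∈ Finset.range p,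
    (N ω (min K (t (k + 1))) - N ω (min K (t k))) ^ 2
  have hSmeas : Measurable S :=
    Finset.measurable_sum _ fun k _ => ((hmeas _).sub (hmeas _)).pow_const 2
  have hη2 : 0 < η / 2 := half_pos hη
  have markov : P {ω | ENNReal.ofReal (η / 2) ≤ ENNReal.ofReal (S ω)}
      ≤ ENNReal.ofReal (2 / η) * ∫⁻ ω, ENNReal.ofReal (S ω) ∂P := by
    refine (meas_ge_le_lintegral_div hSmeas.ennreal_ofReal.aemeasurable
      (ENNReal.ofReal_pos.2 hη2).ne' ENNReal.ofReal_ne_top).trans_eq ?_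
    rw [div_eq_mul_inv, ← ENNReal.ofReal_inv_of_pos hη2, inv_div, mul_comm]
  refine (measure_mono fun ω hω => ?_).trans
    ((measure_union_le _ _).trans (add_le_add_left markov _))
  by_contra hcon
  simp only [Set.mem_union, Set.mem_ofPred_eq, not_or, not_lt] at hcon hω
  have hSω : S ω < η / 2 := not_le.1 fun h => hcon.1 (ENNReal.ofReal_le_ofReal h)
  refine hω.not_ge (ciSup_le fun s => ?_)
  have h₁ := sum_sq_increments_min_le (N ω) ht s.2.2 (ha s s.2.1)
  have h₂ := le_ciSup (bddAbove_range_sq_sub (K := K) (hcont ω) haIcc) s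
  linarith [hcon.2]
end

section
/- Let (Ω, 𝓐, P) be a probability space and for each ℓ ∈ ℕ let N^ℓ : Ω × [0,∞) → ℝ be a process with continuous paths, N^ℓ(ω,0) = 0, and ω ↦ N^ℓ(ω,t) measurable for each t. Let (Π_n) be a sequence of partitions Π_n = {0 = t_{n,0} < t_{n,1} < ... < t_{n,p_n}} tending to the identity, i.e. max_k (t_{n,k+1} − t_{n,k}) → 0 and t_{n,p_n} → ∞ as n → ∞. Assume that for every ℓ ∈ ℕ and every K ∈ ℕ, E[ Σ_{k=0}^{p_n−1} (N^ℓ(K ∧ t_{n,k+1}) − N^ℓ(K ∧ t_{n,k}))² ] → 0 as n → ∞. Then there exists a subsequence (n_j) such that for P-almost every ω, for every ℓ ∈ ℕ and every K > 0, sup_{t ∈ [0,K]} Σ_{k=0}^{p_{n_j}−1} (N^ℓ(t ∧ t_{n_j,k+1}) − N^ℓ(t ∧ t_{n_j,k}))² → 0 as j → ∞, i.e. the discrete quadratic variation sums converge to zero uniformly on every compact interval. -/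
open MeasureTheory Filter

/-- If countably many sequences of nonnegative measurable functions each tend to `0` in `L¹`, then
they tend to `0` almost everywhere along a common subsequence. -/
theorem exists_strictMono_forall_ae_tendsto_zero {Ω ι : Type*} [MeasurableSpace Ω] [Encodable ι]
    {μ : Measure Ω} {f : ι → ℕ → Ω → ENNReal} (hf : ∀ i n, AEMeasurable (f i n) μ)
    (hlim : ∀ i, Tendsto (fun n => ∫⁻ ω, f i n ω ∂μ) atTop (nhds 0)) :
    ∃ φ : ℕ → ℕ, StrictMono φ ∧
      ∀ᵐ ω ∂μ, ∀ i, Tendsto (fun j => f i (φ j) ω) atTop (nhds 0) := by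
  have hev : ∀ j : ℕ, ∀ᶠ n in atTop, ∀ i ∈ {i : ι | Encodable.encode i ≤ j},
      ∫⁻ ω, f i n ω ∂μ < (2⁻¹ : ENNReal) ^ j := fun j => by
    have hfin : {i : ι | Encodable.encode i ≤ j}.Finite :=
      (Set.finite_Iic j).preimage Encodable.encode_injective.injOn
    refine (eventually_all_finite hfin).2 fun i _ => (hlim i).eventually_lt_const ?_
    exact ENNReal.pow_pos (by simp) j
  obtain ⟨φ, hφ, hlt⟩ := extraction_forall_of_eventually hev
  refine ⟨φ, hφ, ae_all_iff.2 fun i => ?_⟩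
  have hsum : ∑' j, ∫⁻ ω, f i (φ (j + Encodable.encode i)) ω ∂μ ≠ ⊤ := by
    refine ne_top_of_le_ne_top (b := ∑' j : ℕ, (2⁻¹ : ENNReal) ^ j) ?_
      (ENNReal.tsum_le_tsum fun j => ?_)
    · simp [ENNReal.tsum_geometric, ENNReal.one_sub_inv_two]
    · exact (hlt _ i (Nat.le_add_left _ _)).le.trans
        (pow_le_pow_right_of_le_one' (by simp) (Nat.le_add_right _ _))
  rw [← lintegral_tsum fun j => hf i _] at hsum
  filter_upwards [ae_lt_top' (AEMeasurable.tsum fun j => hf i _) hsum] with ω hω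
  exact (tendsto_add_atTop_iff_nat (Encodable.encode i)).1
    (ENNReal.tendsto_atTop_zero_of_tsum_ne_top hω.ne)

/-- The quadratic variation of `x` stopped at `s` is at most the one stopped at a later time `M`
plus a bound on the increment of `x` from the last partition point before `s` to `s`. -/
theorem sum_sq_sub_min_le {x : ℝ → ℝ} {p : ℕ} {t : ℕ → ℝ}
    (ht : ∀ k < p, t k < t (k + 1)) {s M c : ℝ} (hsM : s ≤ M) (hc : 0 ≤ c)
    (hx : ∀ k < p, t k < s → s < t (k + 1) → (x s - x (t k)) ^ 2 ≤ c) :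
    ∑ k ∈ Finset.range p, (x (min s (t (k + 1))) - x (min s (t k))) ^ 2 ≤
      ∑ k ∈ Finset.range p, (x (min M (t (k + 1))) - x (min M (t k))) ^ 2 + c := by
  have hmono : MonotoneOn t (Set.Iic p) :=
    (strictMonoOn_Iic_of_lt_succ ht).monotoneOn
  have hcard : ((Finset.range p).filter fun k => t k < s ∧ s < t (k + 1)).card ≤ 1 := by
    refine Finset.card_le_one.2 fun a ha b hb => ?_
    simp only [Finset.mem_filter, Finset.mem_range] at ha hb
    rcases lt_trichotomy a b with h | h | h
    · have := hmono (a := a + 1) (b := b) ha.1 hb.1.le h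
      linarith [ha.2.2, hb.2.1]
    · exact h
    · have := hmono (a := b + 1) (b := a) hb.1 ha.1.le h
      linarith [hb.2.2, ha.2.1]
  calc _ ≤ ∑ k ∈ Finset.range p, ((x (min M (t (k + 1))) - x (min M (t k))) ^ 2 +
        if t k < s ∧ s < t (k + 1) then c else 0) := by
        refine Finset.sum_le_sum fun k hk => ?_
        have hk := Finset.mem_range.1 hk
        have hlt := ht k hk
        split_ifs with h
        · rw [min_eq_left h.2.le, min_eq_right h.1.le]
          linarith [hx k hk h.1 h.2, sq_nonneg (x (min M (t (k + 1))) - x (min M (t k)))]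
        · rcases le_or_gt s (t k) with hs | hs
          · rw [min_eq_left hs, min_eq_left (hs.trans hlt.le)]
            simpa using sq_nonneg _
          · have hs' : t (k + 1) ≤ s := not_lt.1 fun h' => h ⟨hs, h'⟩
            rw [min_eq_right hs', min_eq_right hs.le, min_eq_right (hs'.trans hsM),
              min_eq_right (hs.le.trans hsM), add_zero]
    _ ≤ _ := by
        rw [Finset.sum_add_distrib, ← Finset.sum_filter, Finset.sum_const, nsmul_eq_mul]
        gcongr
        exact mul_le_of_le_one_left hc (by exact_mod_cast hcard)

/-- For a continuous path and partitions with vanishing mesh, convergence to `0` of the quadratic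
variations at a time `M` is uniform over earlier times. -/
theorem tendsto_iSup_sum_sq_sub_min {x : ℝ → ℝ} (hx : Continuous x) {p : ℕ → ℕ} {t : ℕ → ℕ → ℝ}
    (ht0 : ∀ n, t n 0 = 0) (ht : ∀ n, ∀ k < p n, t n k < t n (k + 1))
    (hmesh : ∀ ε : ℝ, 0 < ε → ∀ᶠ n in atTop, ∀ k < p n, t n (k + 1) - t n k < ε)
    {K M : ℝ} (hK : 0 ≤ K) (hKM : K ≤ M)
    (hM : Tendsto (fun n => ∑ k ∈ Finset.range (p n),
      (x (min M (t n (k + 1))) - x (min M (t n k))) ^ 2) atTop (nhds 0)) :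
    Tendsto (fun n => ⨆ s : Set.Icc (0 : ℝ) K, ∑ k ∈ Finset.range (p n),
      (x (min (s : ℝ) (t n (k + 1))) - x (min (s : ℝ) (t n k))) ^ 2) atTop (nhds 0) := by
  have : Nonempty (Set.Icc (0 : ℝ) K) := ⟨⟨0, le_rfl, hK⟩⟩
  have hnonneg : ∀ n, 0 ≤ ⨆ s : Set.Icc (0 : ℝ) K, ∑ k ∈ Finset.range (p n),
      (x (min (s : ℝ) (t n (k + 1))) - x (min (s : ℝ) (t n k))) ^ 2 := fun n =>
    Real.iSup_nonneg fun s => Finset.sum_nonneg fun k _ => sq_nonneg _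
  refine tendsto_order.2 ⟨fun a ha => .of_forall fun n => ha.trans_le (hnonneg n),
    fun ε hε => ?_⟩
  obtain ⟨δ, hδ, hδx⟩ := Metric.uniformContinuousOn_iff.1
    (isCompact_Icc.uniformContinuousOn_of_continuous (s := Set.Icc 0 K) hx.continuousOn)
    (√(ε / 3)) (by positivity)
  filter_upwards [hmesh δ hδ, hM.eventually_lt_const (show 0 < ε / 3 by positivity)] with n hn hMn
  refine (ciSup_le fun s => ?_).trans_lt (show ε / 3 + ε / 3 < ε by linarith)
  refine (sum_sq_sub_min_le (ht n) (s.2.2.trans hKM) (c := ε / 3) (by positivity)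
    fun k hk hks hsk => ?_).trans (by gcongr)
  have htk : 0 ≤ t n k := ht0 n ▸
    (strictMonoOn_Iic_of_lt_succ (ht n)).monotoneOn (Nat.zero_le _) hk.le (Nat.zero_le k)
  have hdist := hδx s s.2 (t n k) ⟨htk, hks.le.trans s.2.2⟩
    (by rw [Real.dist_eq, abs_of_pos (sub_pos.2 hks)]; linarith [hn k hk])
  rw [Real.dist_eq] at hdist
  simpa using (Real.le_sqrt (abs_nonneg _) (by positivity)).1 hdist.le

open MeasureTheory Filter

/-- If `(N^ℓ)` are continuous processes starting from `0` whose expected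
discrete quadratic variations along a sequence of partitions tending to the
identity vanish asymptotically at every integer time, then along a suitable
subsequence of the partitions the running discrete quadratic variation sums
converge to `0` uniformly on every compact interval, almost surely and
simultaneously for all `ℓ`. -/
theorem statement10 {Ω : Type*} [MeasurableSpace Ω] (P : Measure Ω)
    [IsProbabilityMeasure P]
    (N : ℕ → Ω → ℝ → ℝ)
    (hcont : ∀ ℓ ω, Continuous (N ℓ ω))
    (hzero : ∀ ℓ ω, N ℓ ω 0 = 0)
    (hmeas : ∀ (ℓ : ℕ) (s : ℝ), Measurable fun ω => N ℓ ω s)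
    (p : ℕ → ℕ) (t : ℕ → ℕ → ℝ)
    (ht0 : ∀ n, t n 0 = 0)
    (htmono : ∀ n, ∀ k < p n, t n k < t n (k + 1))
    (hmesh : ∀ ε : ℝ, 0 < ε → ∃ n₀, ∀ n ≥ n₀, ∀ k < p n, t n (k + 1) - t n k < ε)
    (hlast : Tendsto (fun n => t n (p n)) atTop atTop)
    (hE : ∀ ℓ : ℕ, ∀ K : ℕ, Tendsto (fun n =>
        ∫⁻ ω, ENNReal.ofReal (∑ k ∈ Finset.range (p n),
          (N ℓ ω (min (K : ℝ) (t n (k + 1))) - N ℓ ω (min (K : ℝ) (t n k))) ^ 2)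
          ∂P)
      atTop (nhds 0)) :
    ∃ φ : ℕ → ℕ, StrictMono φ ∧
      ∀ᵐ ω ∂P, ∀ ℓ : ℕ, ∀ K : ℝ, 0 < K →
        Tendsto (fun j => ⨆ s : Set.Icc (0 : ℝ) K,
            ∑ k ∈ Finset.range (p (φ j)),
              (N ℓ ω (min (s : ℝ) (t (φ j) (k + 1)))
                - N ℓ ω (min (s : ℝ) (t (φ j) k))) ^ 2)
          atTop (nhds 0) := by
  obtain ⟨φ, hφ, hae⟩ := exists_strictMono_forall_ae_tendsto_zero (ι := ℕ × ℕ) (μ := P)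
    (f := fun i n ω => ENNReal.ofReal (∑ k ∈ Finset.range (p n),
      (N i.1 ω (min (i.2 : ℝ) (t n (k + 1))) - N i.1 ω (min (i.2 : ℝ) (t n k))) ^ 2))
    (fun i n => (ENNReal.measurable_ofReal.comp <| Finset.measurable_fun_sum _ fun k _ =>
      ((hmeas _ _).sub (hmeas _ _)).pow_const 2).aemeasurable)
    fun i => hE i.1 i.2
  refine ⟨φ, hφ, ?_⟩
  filter_upwards [hae] with ω hω ℓ K hK
  obtain ⟨M, hM⟩ := exists_nat_ge K
  refine tendsto_iSup_sum_sq_sub_min (hcont ℓ ω) (fun n => ht0 _) (fun n => htmono _)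
    (fun ε hε => hφ.tendsto_atTop.eventually (eventually_atTop.2 (hmesh ε hε))) hK.le hM ?_
  refine ((ENNReal.tendsto_toReal ENNReal.zero_ne_top).comp (hω (ℓ, M))).congr fun j => ?_
  exact ENNReal.toReal_ofReal (Finset.sum_nonneg fun k _ => sq_nonneg _)
end
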